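/- Let D ≥ 1 be an integer, let Q ⊂ ℝ^D be an embedded set, let c ∈ ℝ^D, and let w ≥ 2ℓ > 0 be reals. Let H = c + [−w/2, w/2]^D be the cube of side length w centered at c, and H^− = c + [−w/2 + ℓ, w/2 − ℓ]^D the concentric cube of side length w − 2ℓ. Then |Q ∩ (H \ H^−)| ≤ 2D · (2^D / vol(B_D)) · (1 + ℓ) · (1 + w)^{D−1}. -/

import Mathlib

open MeasureTheory

/-- Packing bound: the balls of radius `1/2` around `1`-separated points of the box `∏ᵢ [aᵢ, bᵢ]`
are disjoint and lie in the box enlarged by `1/2` in every direction. -/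
theorem card_le_of_separated_of_mem_box {ι : Type*} [Fintype ι]
    (S : Finset (EuclideanSpace ℝ ι))
    (hS : ∀ p ∈ S, ∀ q ∈ S, p ≠ q → 1 ≤ dist p q) (a b : ι → ℝ) (hab : a ≤ b)
    (hbox : ∀ p ∈ S, ∀ i, p i ∈ Set.Icc (a i) (b i)) :
    (S.card : ℝ) ≤
      2 ^ Fintype.card ι / (volume (Metric.ball (0 : EuclideanSpace ℝ ι) 1)).toReal *
        ∏ i, (1 + (b i - a i)) := by
  set V := volume (Metric.ball (0 : EuclideanSpace ℝ ι) 1) with hV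
  have hVtop : V ≠ ⊤ := measure_ball_lt_top.ne
  have hVpos : 0 < V.toReal :=
    ENNReal.toReal_pos (Metric.measure_ball_pos _ _ one_pos).ne' hVtop
  let B : Set (ι → ℝ) := Set.Icc (fun i => a i - 1 / 2) (fun i => b i + 1 / 2)
  have hsub : ⋃ p ∈ S, Metric.ball p (1 / 2) ⊆ WithLp.ofLp ⁻¹' B := by
    intro x hx
    simp only [Set.mem_iUnion, Metric.mem_ball] at hx
    obtain ⟨p, hp, hxp⟩ := hx
    have hi (i : ι) : |x i - p i| < 1 / 2 := by
      refine lt_of_le_of_lt ?_ hxp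
      simpa [dist_eq_norm] using PiLp.norm_apply_le (x - p) i
    refine ⟨fun i => ?_, fun i => ?_⟩
    · have := (abs_lt.1 (hi i)).1
      have := (hbox p hp i).1
      change a i - 1 / 2 ≤ x i
      linarith
    · have := (abs_lt.1 (hi i)).2
      have := (hbox p hp i).2
      change x i ≤ b i + 1 / 2
      linarith
  have hdisj : (S : Set (EuclideanSpace ℝ ι)).PairwiseDisjoint
      fun p => Metric.ball p (1 / 2 : ℝ) := fun p hp q hq hpq =>
    Metric.ball_disjoint_ball (by linarith [hS p hp q hq hpq])
  have hle := measure_mono (μ := volume) hsub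
  rw [measure_biUnion_finset hdisj fun _ _ => measurableSet_ball,
    (PiLp.volume_preserving_ofLp ι).measure_preimage measurableSet_Icc.nullMeasurableSet,
    Real.volume_Icc_pi] at hle
  have hball (p : EuclideanSpace ℝ ι) : volume (Metric.ball p (1 / 2 : ℝ)) =
      ENNReal.ofReal ((1 / 2) ^ Fintype.card ι) * V := by
    rw [Measure.addHaar_ball_of_pos _ _ (by norm_num), finrank_euclideanSpace]
  simp only [hball, Finset.sum_const, nsmul_eq_mul] at hle
  have hreal := ENNReal.toReal_mono (ENNReal.prod_ne_top fun _ _ => ENNReal.ofReal_ne_top) hle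
  rw [ENNReal.toReal_mul, ENNReal.toReal_mul, ENNReal.toReal_prod, ENNReal.toReal_natCast,
    ENNReal.toReal_ofReal (by positivity)] at hreal
  have hprod : ∏ i, (ENNReal.ofReal (b i + 1 / 2 - (a i - 1 / 2))).toReal =
      ∏ i, (1 + (b i - a i)) := by
    refine Finset.prod_congr rfl fun i _ => ?_
    rw [ENNReal.toReal_ofReal (by linarith [hab i])]
    ring
  rw [hprod, one_div, inv_pow] at hreal
  rw [div_mul_eq_mul_div, le_div_iff₀ hVpos]
  calc (S.card : ℝ) * V.toReal
      = 2 ^ Fintype.card ι * (S.card * ((2 ^ Fintype.card ι)⁻¹ * V.toReal)) := by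
        field_simp
    _ ≤ _ := by gcongr

/-- The packing bound for a slab of thickness `ℓ` in direction `i`, lying in a cube of side
length `w`. -/
theorem card_le_of_separated_of_mem_slab {ι : Type*} [Fintype ι] [DecidableEq ι]
    (S : Finset (EuclideanSpace ℝ ι))
    (hS : ∀ p ∈ S, ∀ q ∈ S, p ≠ q → 1 ≤ dist p q) (a : ι → ℝ) (i : ι) (t : ℝ)
    {w ℓ : ℝ} (hℓ : 0 ≤ ℓ) (hw : 0 ≤ w)
    (hcube : ∀ p ∈ S, ∀ j, p j ∈ Set.Icc (a j) (a j + w))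
    (hslab : ∀ p ∈ S, p i ∈ Set.Icc t (t + ℓ)) :
    (S.card : ℝ) ≤
      2 ^ Fintype.card ι / (volume (Metric.ball (0 : EuclideanSpace ℝ ι) 1)).toReal *
        (1 + ℓ) * (1 + w) ^ (Fintype.card ι - 1) := by
  have key := card_le_of_separated_of_mem_box S hS (Function.update a i t)
    (fun j => Function.update a i t j + if j = i then ℓ else w)
    (fun j => by dsimp only; split_ifs <;> linarith)
    (fun p hp j => by
      rcases eq_or_ne j i with rfl | hj
      · simpa using hslab p hp
      · simpa [hj] using hcube p hp j)
  have hprod : ∏ j, (1 + (Function.update a i t j + (if j = i then ℓ else w) -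
      Function.update a i t j)) = (1 + ℓ) * (1 + w) ^ (Fintype.card ι - 1) := by
    simp only [add_sub_cancel_left]
    rw [← Finset.mul_prod_erase _ _ (Finset.mem_univ i), if_pos rfl,
      Finset.prod_congr rfl fun j hj => by rw [if_neg (Finset.ne_of_mem_erase hj)],
      Finset.prod_const, Finset.card_erase_of_mem (Finset.mem_univ i), Finset.card_univ]
  rw [hprod, ← mul_assoc] at key
  exact key

/-- Bound on the 'type (i)' points: an embedded set `Q ⊂ ℝ^D` meets the cubic shell
`H \ H⁻` (between the concentric cubes of side lengths `w - 2ℓ` and `w` centered at `c`,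
with `w ≥ 2ℓ > 0`) in at most `2D · (2^D / vol(B_D)) · (1+ℓ) · (1+w)^{D-1}` points. -/
theorem inner_shell_count (D : ℕ) (hD : 1 ≤ D)
    (Q : Set (EuclideanSpace ℝ (Fin D))) (hQfin : Q.Finite)
    (hQ : ∀ p ∈ Q, ∀ q ∈ Q, p ≠ q → 1 ≤ dist p q)
    (c : EuclideanSpace ℝ (Fin D)) (w ℓ : ℝ) (hℓ : 0 < ℓ) (hw : 2 * ℓ ≤ w) :
    ((Q ∩ ({p : EuclideanSpace ℝ (Fin D) |
          ∀ i, p i ∈ Set.Icc (c i - w / 2) (c i + w / 2)} \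
        {p : EuclideanSpace ℝ (Fin D) |
          ∀ i, p i ∈ Set.Icc (c i - (w / 2 - ℓ)) (c i + (w / 2 - ℓ))})).ncard : ℝ) ≤
      2 * D * (2 ^ D / (volume (Metric.ball (0 : EuclideanSpace ℝ (Fin D)) 1)).toReal) *
        (1 + ℓ) * (1 + w) ^ (D - 1) := by
  classical
  set C : ℝ := 2 ^ D / (volume (Metric.ball (0 : EuclideanSpace ℝ (Fin D)) 1)).toReal *
    (1 + ℓ) * (1 + w) ^ (D - 1) with hC
  let T := hQfin.toFinset.filter fun p => ∀ i, p i ∈ Set.Icc (c i - w / 2) (c i - w / 2 + w)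
  have hT (p) (hp : p ∈ T) : p ∈ Q ∧ ∀ i, p i ∈ Set.Icc (c i - w / 2) (c i - w / 2 + w) := by
    simpa [T] using hp
  let slab (i : Fin D) (t : ℝ) := T.filter fun p => p i ∈ Set.Icc t (t + ℓ)
  have hslab (i : Fin D) (t : ℝ) : ((slab i t).card : ℝ) ≤ C := by
    have hmem (p) (hp : p ∈ slab i t) : p ∈ T ∧ p i ∈ Set.Icc t (t + ℓ) := by
      simpa only [slab, Finset.mem_filter] using hp
    simpa [hC] using card_le_of_separated_of_mem_slab (slab i t)
      (fun p hp q hq => hQ p (hT p (hmem p hp).1).1 q (hT q (hmem q hq).1).1)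
      (fun j => c j - w / 2) i t hℓ.le (by linarith : 0 ≤ w)
      (fun p hp => (hT p (hmem p hp).1).2) (fun p hp => (hmem p hp).2)
  let U := Finset.univ.biUnion fun i => slab i (c i - w / 2) ∪ slab i (c i + w / 2 - ℓ)
  have hU : (U.card : ℝ) ≤ 2 * D * C := by
    have h : (U.card : ℝ) ≤ ∑ i : Fin D, 2 * C := by
      refine le_trans (Nat.cast_le.2 Finset.card_biUnion_le) ?_
      push_cast
      refine Finset.sum_le_sum fun i _ => ?_
      have h1 := hslab i (c i - w / 2)
      have h2 := hslab i (c i + w / 2 - ℓ)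
      have h3 : ((slab i (c i - w / 2) ∪ slab i (c i + w / 2 - ℓ)).card : ℝ) ≤
          (slab i (c i - w / 2)).card + (slab i (c i + w / 2 - ℓ)).card := by
        exact_mod_cast Finset.card_union_le _ _
      linarith
    refine h.trans_eq ?_
    simp only [Finset.sum_const, Finset.card_univ, Fintype.card_fin, nsmul_eq_mul]
    ring
  refine le_trans ?_ (hU.trans_eq (by rw [hC]; ring))
  rw [← Set.ncard_coe_finset, Nat.cast_le]
  refine Set.ncard_le_ncard ?_ U.finite_toSet
  rintro p ⟨hpQ, hpH, hpI⟩
  simp only [Set.mem_ofPred_eq, not_forall] at hpH hpI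
  obtain ⟨i, hi⟩ := hpI
  have hpT : p ∈ T := by
    simp only [T, Finset.mem_filter, Set.Finite.mem_toFinset]
    exact ⟨hpQ, fun j => ⟨(hpH j).1, by linarith [(hpH j).2]⟩⟩
  simp only [U, slab, Finset.coe_biUnion, Set.mem_iUnion, Finset.mem_coe, Finset.mem_union,
    Finset.mem_filter]
  refine ⟨i, Finset.mem_univ i, ?_⟩
  rcases le_or_gt (c i - (w / 2 - ℓ)) (p i) with h | h
  · have h' : c i + (w / 2 - ℓ) < p i := not_le.1 fun h' => hi ⟨h, h'⟩
    exact Or.inr ⟨hpT, by linarith, by linarith [(hpH i).2]⟩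
  · exact Or.inl ⟨hpT, (hpH i).1, by linarith⟩
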